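/- Suppose the crossed-product conditions (C1)–(C5) hold, R carries an involution r ↦ r̄, and w : G → R satisfies the w-conditions (W1)–(W4); write S = R∗_{c,τ}G with its involution σ given by σ(Σ_g r_g·g) = Σ_g (w(g)·c_{g⁻¹}(r̄_g))·g⁻¹, and regard R ⊆ S via r ↦ r·e. For a left R-module M let M* = Hom_R(M,R) with left R-action (r·f)(x) = f(x)·r̄, and let (S⊗_R M)* = Hom_S(S⊗_R M, S) with left S-action (s·F)(y) = F(y)·σ(s). Then there is a well-defined S-linear map β(M) : S⊗_R M* → (S⊗_R M)* satisfying β(M)(u⊗f)(v⊗m) = v·f(m)·σ(u) for u,v ∈ S, f ∈ M*, m ∈ M; β(M) is natural in M; and β(M) is bijective whenever M is a finitely generated free left R-module. -/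

import Mathlib

universe u v

variable {R : Type u} [Ring R] {G : Type v} [Group G]

/-- (C1): `c_{τ(g,g')} ∘ c_{gg'} = c_g ∘ c_{g'}`, where `c_u` is conjugation by the unit `u`. -/
def CondC1 (c : G → R ≃+* R) (τ : G → G → Rˣ) : Prop :=
  ∀ (g g' : G) (r : R),
    (τ g g' : R) * c (g * g') r * (((τ g g')⁻¹ : Rˣ) : R) = c g (c g' r)

/-- (C2): `τ(g,g')·τ(gg',g'') = c_g(τ(g',g''))·τ(g,g'g'')`. -/
def CondC2 (c : G → R ≃+* R) (τ : G → G → Rˣ) : Prop :=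
  ∀ g g' g'' : G,
    (τ g g' : R) * ((τ (g * g') g'' : Rˣ) : R) =
      c g ((τ g' g'' : Rˣ) : R) * ((τ g (g' * g'') : Rˣ) : R)

/-- (C3): `c_e = id`. -/
def CondC3 (c : G → R ≃+* R) : Prop := c (1 : G) = RingEquiv.refl R

/-- (C4): `τ(e,g) = 1`. -/
def CondC4 (τ : G → G → Rˣ) : Prop := ∀ g : G, τ 1 g = 1

/-- (C5): `τ(g,e) = 1`. -/
def CondC5 (τ : G → G → Rˣ) : Prop := ∀ g : G, τ g 1 = 1


/-- The multiplication of the crossed product `R ∗_{c,τ} G` on the free left `R`-module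
`G →₀ R` on `G`: the unique biadditive map with
`(λ·g)·(μ·h) = (λ · c_g(μ) · τ(g,h)) · (gh)`. -/
noncomputable def crossedMul (c : G → R ≃+* R) (τ : G → G → Rˣ) (x y : G →₀ R) : G →₀ R :=
  x.sum fun g r => y.sum fun h s => Finsupp.single (g * h) (r * c g s * ((τ g h : Rˣ) : R))

/-- A ring involution: `σ 1 = 1`, `σ` is additive, anti-multiplicative and of order two. -/
def IsRingInvolution (σ : R → R) : Prop :=
  σ 1 = 1 ∧ (∀ a b : R, σ (a + b) = σ a + σ b) ∧
    (∀ a b : R, σ (a * b) = σ b * σ a) ∧ ∀ a : R, σ (σ a) = a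

/-- (W1): `w(e) = 1`. -/
def CondW1 (w : G → R) : Prop := w (1 : G) = 1

/-- (W2): `w(gh) = w(h)·c_{h⁻¹}(w(g))·τ(h⁻¹,g⁻¹)·c_{(gh)⁻¹}(τ(g,h)‾)⁻¹`
(the last factor is the ring inverse of `c_{(gh)⁻¹}(σ(τ(g,h)))`, taken via `Ring.inverse`). -/
def CondW2 (σ : R → R) (c : G → R ≃+* R) (τ : G → G → Rˣ) (w : G → R) : Prop :=
  ∀ g h : G,
    w (g * h) =
      w h * c h⁻¹ (w g) * ((τ h⁻¹ g⁻¹ : Rˣ) : R) *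
        Ring.inverse (c (g * h)⁻¹ (σ ((τ g h : Rˣ) : R)))

/-- (W3): `σ(w(g)) = w(g)·c_g⁻¹(τ(g,g⁻¹)·(σ(τ(g,g⁻¹)))⁻¹)`, where `c_g⁻¹` is the inverse
automorphism of `c_g`. -/
def CondW3 (σ : R → R) (c : G → R ≃+* R) (τ : G → G → Rˣ) (w : G → R) : Prop :=
  ∀ g : G,
    σ (w g) =
      w g * (c g).symm (((τ g g⁻¹ : Rˣ) : R) * Ring.inverse (σ ((τ g g⁻¹ : Rˣ) : R)))

/-- (W4): `σ(c_g(r)) = c_g((w(g)·τ(g⁻¹,g))⁻¹ · σ(r) · (w(g)·τ(g⁻¹,g)))`. -/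
def CondW4 (σ : R → R) (c : G → R ≃+* R) (τ : G → G → Rˣ) (w : G → R) : Prop :=
  ∀ (g : G) (r : R),
    σ (c g r) =
      c g (Ring.inverse (w g * ((τ g⁻¹ g : Rˣ) : R)) * σ r *
        (w g * ((τ g⁻¹ g : Rˣ) : R)))

/-- The candidate involution on the crossed product:
`Σ_g r_g·g ↦ Σ_g (w(g)·c_{g⁻¹}(σ(r_g)))·g⁻¹`. -/
noncomputable def crossedStar (σ : R → R) (c : G → R ≃+* R) (w : G → R)
    (x : G →₀ R) : G →₀ R :=
  x.sum fun g r => Finsupp.single g⁻¹ (w g * c g⁻¹ (σ r))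

universe w

/-- The left `R`-action on the dual `M* = Hom_R(M,R)`: `(r·f)(x) = f(x)·σ(r)`. -/
noncomputable def dualSMul (σ : R → R) {M : Type w} [AddCommGroup M] [Module R M]
    (r : R) (f : M →ₗ[R] R) : M →ₗ[R] R where
  toFun x := f x * σ r
  map_add' x y := by simp [add_mul]
  map_smul' a x := by simp [mul_assoc]

/-- The action of `S = R ∗_{c,τ} G` on `S ⊗_R M`, realised on `G →₀ M` via
`(λ·g) ⊗ x = (1·g) ⊗ c_g⁻¹(λ)·x` (`Finsupp.single 1 x` corresponds to `1 ⊗ x`). -/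
noncomputable def crossedSMul (c : G → R ≃+* R) (τ : G → G → Rˣ)
    {M : Type w} [AddCommGroup M] [Module R M]
    (u : G →₀ R) (z : G →₀ M) : G →₀ M :=
  u.sum fun g r => z.sum fun h x =>
    Finsupp.single (g * h) (((c (g * h)).symm (r * ((τ g h : Rˣ) : R))) • x)

/-- The action of `S = R ∗_{c,τ} G` on `S ⊗_R M*`, realised on `G →₀ (M →ₗ[R] R)`, where
`M*` carries the left action `(r·f)(x) = f(x)·σ(r)`. -/
noncomputable def crossedSMulDual (c : G → R ≃+* R) (τ : G → G → Rˣ) (σ : R → R)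
    {M : Type w} [AddCommGroup M] [Module R M]
    (u : G →₀ R) (ζ : G →₀ (M →ₗ[R] R)) : G →₀ (M →ₗ[R] R) :=
  u.sum fun g r => ζ.sum fun h f =>
    Finsupp.single (g * h) (dualSMul σ ((c (g * h)).symm (r * ((τ g h : Rˣ) : R))) f)

/-- The characterising property of `β(M) : S ⊗_R M* → (S ⊗_R M)*`: each `B(ζ)` is `S`-linear
(for the left `S`-module structure on `S ⊗_R M` and with `(S ⊗_R M)* = Hom_S(S ⊗_R M, S)`
carrying the action `(s·F)(y) = F(y)·σ̂(s)` for the involution `σ̂` of `S` determined by `w`),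
`B` is additive and `S`-linear, and `B(u ⊗ f)(v ⊗ m) = v·f(m)·σ̂(u)`. -/
def IsDualComparison (c : G → R ≃+* R) (τ : G → G → Rˣ) (σ : R → R) (w : G → R)
    {M : Type w} [AddCommGroup M] [Module R M]
    (B : (G →₀ (M →ₗ[R] R)) → ((G →₀ M) → (G →₀ R))) : Prop :=
  (∀ ζ : G →₀ (M →ₗ[R] R),
      (∀ z z' : G →₀ M, B ζ (z + z') = B ζ z + B ζ z') ∧
      (∀ (u : G →₀ R) (z : G →₀ M),
        B ζ (crossedSMul c τ u z) = crossedMul c τ u (B ζ z))) ∧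
  (∀ (ζ ζ' : G →₀ (M →ₗ[R] R)) (z : G →₀ M), B (ζ + ζ') z = B ζ z + B ζ' z) ∧
  (∀ (u : G →₀ R) (ζ : G →₀ (M →ₗ[R] R)) (z : G →₀ M),
      B (crossedSMulDual c τ σ u ζ) z = crossedMul c τ (B ζ z) (crossedStar σ c w u)) ∧
  (∀ (u v : G →₀ R) (f : M →ₗ[R] R) (m : M),
      B (crossedSMulDual c τ σ u (Finsupp.single (1 : G) f))
          (crossedSMul c τ v (Finsupp.single (1 : G) m)) =
        crossedMul c τ (crossedMul c τ v (Finsupp.single (1 : G) (f m)))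
          (crossedStar σ c w u))

section Biadditivity

variable (c : G → R ≃+* R) (τ : G → G → Rˣ)
variable {M : Type w} [AddCommGroup M] [Module R M]

lemma crossedMul_single (g h : G) (r s : R) :
    crossedMul c τ (Finsupp.single g r) (Finsupp.single h s) =
      Finsupp.single (g * h) (r * c g s * (τ g h : R)) := by
  simp [crossedMul]

lemma crossedMul_add_left (x x' y : G →₀ R) :
    crossedMul c τ (x + x') y = crossedMul c τ x y + crossedMul c τ x' y := by
  unfold crossedMul
  rw [Finsupp.sum_add_index'] <;> simp [add_mul, Finsupp.sum_add]

lemma crossedMul_add_right (x y y' : G →₀ R) :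
    crossedMul c τ x (y + y') = crossedMul c τ x y + crossedMul c τ x y' := by
  unfold crossedMul
  rw [← Finsupp.sum_add]
  refine Finsupp.sum_congr fun g _ => ?_
  rw [Finsupp.sum_add_index'] <;> simp [mul_add, add_mul]

lemma crossedMul_zero_left (y : G →₀ R) : crossedMul c τ 0 y = 0 := by
  simp [crossedMul]

lemma crossedMul_zero_right (x : G →₀ R) : crossedMul c τ x 0 = 0 := by
  simp [crossedMul]

lemma crossedSMul_single (g h : G) (r : R) (x : M) :
    crossedSMul c τ (Finsupp.single g r) (Finsupp.single h x) =
      Finsupp.single (g * h) ((c (g * h)).symm (r * (τ g h : R)) • x) := by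
  simp [crossedSMul]

lemma crossedSMul_add_left (u u' : G →₀ R) (z : G →₀ M) :
    crossedSMul c τ (u + u') z = crossedSMul c τ u z + crossedSMul c τ u' z := by
  unfold crossedSMul
  rw [Finsupp.sum_add_index'] <;> simp [add_mul, add_smul, Finsupp.sum_add]

lemma crossedSMul_add_right (u : G →₀ R) (z z' : G →₀ M) :
    crossedSMul c τ u (z + z') = crossedSMul c τ u z + crossedSMul c τ u z' := by
  unfold crossedSMul
  rw [← Finsupp.sum_add]
  refine Finsupp.sum_congr fun g _ => ?_
  rw [Finsupp.sum_add_index'] <;> simp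

lemma crossedSMul_zero_left (z : G →₀ M) : crossedSMul c τ 0 z = 0 := by
  simp [crossedSMul]

lemma crossedSMul_zero_right (u : G →₀ R) : crossedSMul c τ u (0 : G →₀ M) = 0 := by
  simp [crossedSMul]

end Biadditivity

namespace IsRingInvolution

lemma map_zero {σ : R → R} (hσ : IsRingInvolution σ) : σ 0 = 0 := by
  have h := hσ.2.1 0 0
  simpa using h

lemma isUnit_map {σ : R → R} (hσ : IsRingInvolution σ) {a : R} (ha : IsUnit a) : IsUnit (σ a) := by
  obtain ⟨u, rfl⟩ := ha
  refine ⟨⟨σ u, σ ((u⁻¹ : Rˣ) : R), ?_, ?_⟩, rfl⟩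
  · rw [← hσ.2.2.1, Units.inv_mul, hσ.1]
  · rw [← hσ.2.2.1, Units.mul_inv, hσ.1]

end IsRingInvolution

section Dual

variable {M : Type w} [AddCommGroup M] [Module R M]

lemma dualSMul_one {σ : R → R} (hσ : IsRingInvolution σ) (f : M →ₗ[R] R) :
    dualSMul σ 1 f = f := by
  ext x; simp [dualSMul, hσ.1]

lemma dualSMul_zero_left {σ : R → R} (hσ : IsRingInvolution σ) (f : M →ₗ[R] R) :
    dualSMul σ 0 f = 0 := by
  ext x; simp [dualSMul, hσ.map_zero]

lemma dualSMul_zero_right (σ : R → R) (r : R) :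
    dualSMul σ r (0 : M →ₗ[R] R) = 0 := by
  ext x; simp [dualSMul]

lemma dualSMul_add_left {σ : R → R} (hσ : IsRingInvolution σ) (r s : R) (f : M →ₗ[R] R) :
    dualSMul σ (r + s) f = dualSMul σ r f + dualSMul σ s f := by
  ext x; simp [dualSMul, hσ.2.1, mul_add]

lemma dualSMul_add_right (σ : R → R) (r : R) (f f' : M →ₗ[R] R) :
    dualSMul σ r (f + f') = dualSMul σ r f + dualSMul σ r f' := by
  ext x; simp [dualSMul, add_mul]

variable (c : G → R ≃+* R) (τ : G → G → Rˣ) {σ : R → R}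

lemma crossedSMulDual_single (hσ : IsRingInvolution σ) (g h : G) (r : R) (f : M →ₗ[R] R) :
    crossedSMulDual c τ σ (Finsupp.single g r) (Finsupp.single h f) =
      Finsupp.single (g * h) (dualSMul σ ((c (g * h)).symm (r * (τ g h : R))) f) := by
  simp [crossedSMulDual, dualSMul_zero_left hσ, dualSMul_zero_right]

lemma crossedSMulDual_add_left (hσ : IsRingInvolution σ) (u u' : G →₀ R)
    (ζ : G →₀ (M →ₗ[R] R)) :
    crossedSMulDual c τ σ (u + u') ζ =
      crossedSMulDual c τ σ u ζ + crossedSMulDual c τ σ u' ζ := by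
  unfold crossedSMulDual
  rw [Finsupp.sum_add_index'] <;>
    simp [add_mul, dualSMul_zero_left hσ, dualSMul_add_left hσ, Finsupp.sum_add]

lemma crossedSMulDual_add_right (u : G →₀ R) (ζ ζ' : G →₀ (M →ₗ[R] R)) :
    crossedSMulDual c τ σ u (ζ + ζ') =
      crossedSMulDual c τ σ u ζ + crossedSMulDual c τ σ u ζ' := by
  unfold crossedSMulDual
  rw [← Finsupp.sum_add]
  refine Finsupp.sum_congr fun g _ => ?_
  rw [Finsupp.sum_add_index'] <;> simp [dualSMul_zero_right, dualSMul_add_right]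

lemma crossedSMulDual_zero_left (ζ : G →₀ (M →ₗ[R] R)) : crossedSMulDual c τ σ 0 ζ = 0 := by
  simp [crossedSMulDual]

lemma crossedSMulDual_zero_right (u : G →₀ R) :
    crossedSMulDual c τ σ u (0 : G →₀ (M →ₗ[R] R)) = 0 := by
  simp [crossedSMulDual]

end Dual

section Star

variable (c : G → R ≃+* R) (w : G → R) {σ : R → R}

lemma crossedStar_single (hσ : IsRingInvolution σ) (g : G) (r : R) :
    crossedStar σ c w (Finsupp.single g r) = Finsupp.single g⁻¹ (w g * c g⁻¹ (σ r)) := by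
  simp [crossedStar, hσ.map_zero, -Finsupp.single_mul]

lemma crossedStar_add (hσ : IsRingInvolution σ) (u u' : G →₀ R) :
    crossedStar σ c w (u + u') = crossedStar σ c w u + crossedStar σ c w u' := by
  unfold crossedStar
  rw [Finsupp.sum_add_index'] <;> simp [hσ.map_zero, hσ.2.1, mul_add, -Finsupp.single_mul]

lemma crossedStar_zero : crossedStar σ c w 0 = 0 := by
  simp [crossedStar]

end Star

section CrossedProduct

variable {c : G → R ≃+* R} {τ : G → G → Rˣ} {σ : R → R} {w : G → R}

lemma CondC1.mul_eq (h1 : CondC1 c τ) (g h : G) (r : R) :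
    c g (c h r) * (τ g h : R) = (τ g h : R) * c (g * h) r := by
  rw [← h1]; simp [mul_assoc]

lemma CondC3.apply (h3 : CondC3 c) (r : R) : c 1 r = r := by
  rw [h3, RingEquiv.refl_apply]

lemma crossedMul_assoc (h1 : CondC1 c τ) (h2 : CondC2 c τ) (x y z : G →₀ R) :
    crossedMul c τ (crossedMul c τ x y) z = crossedMul c τ x (crossedMul c τ y z) := by
  induction x using Finsupp.induction_linear with
  | zero => simp [crossedMul_zero_left]
  | add x x' hx hx' => simp [crossedMul_add_left, hx, hx']
  | single g r =>
  induction y using Finsupp.induction_linear with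
  | zero => simp [crossedMul_zero_left, crossedMul_zero_right]
  | add y y' hy hy' => simp [crossedMul_add_left, crossedMul_add_right, hy, hy']
  | single h s =>
  induction z using Finsupp.induction_linear with
  | zero => simp [crossedMul_zero_right]
  | add z z' hz hz' => simp [crossedMul_add_right, hz, hz']
  | single k t =>
  simp only [crossedMul_single, mul_assoc, map_mul]
  rw [← h2, ← mul_assoc (c g (c h t)), h1.mul_eq, mul_assoc]

lemma CondW2.isUnit (hσ : IsRingInvolution σ) (hw2 : CondW2 σ c τ w) (hw1 : CondW1 w) (g : G) :
    IsUnit (w g) := by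
  have key (h : G) : IsUnit (w h⁻¹ * c h (w h)) := by
    have e := hw2 h h⁻¹
    rw [mul_inv_cancel, hw1, inv_inv] at e
    have hu : IsUnit (Ring.inverse (c (1 : G)⁻¹ (σ (τ h h⁻¹ : R)))) :=
      ((hσ.isUnit_map (τ h h⁻¹).isUnit).map _).ringInverse
    have hu' := (τ h h⁻¹).isUnit.mul hu
    rw [mul_assoc] at e
    have := isUnit_one (M := R)
    rw [e] at this
    exact (IsUnit.mul_right_iff hu').1 this
  obtain ⟨a, ha⟩ := (key g).exists_left_inv
  obtain ⟨b, hb⟩ := (key g⁻¹).exists_right_inv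
  rw [inv_inv] at hb
  refine isUnit_iff_exists_and_exists.2 ⟨⟨_, (mul_assoc _ _ _).symm.trans hb⟩,
    (c g).symm (a * w g⁻¹), (c g).injective ?_⟩
  simp only [map_mul, RingEquiv.apply_symm_apply, map_one]
  rw [mul_assoc, ha]

lemma CondW4.mul_eq (hw4 : CondW4 σ c τ w) (h1 : CondC1 c τ) (h3 : CondC3 c)
    (hw : ∀ g, IsUnit (w g)) (g : G) (r : R) :
    w g * c g⁻¹ (σ (c g r)) = σ r * w g := by
  have hu : IsUnit (w g * (τ g⁻¹ g : R)) := (hw g).mul (τ g⁻¹ g).isUnit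
  rw [hw4, ← h1]
  simp only [inv_mul_cancel, h3.apply, ← mul_assoc]
  rw [Ring.mul_inverse_cancel _ hu]
  simp [mul_assoc]

lemma crossedStar_mul (hσ : IsRingInvolution σ) (h1 : CondC1 c τ) (h3 : CondC3 c)
    (hw : ∀ g, IsUnit (w g)) (hw2 : CondW2 σ c τ w) (hw4 : CondW4 σ c τ w) (x y : G →₀ R) :
    crossedStar σ c w (crossedMul c τ x y) =
      crossedMul c τ (crossedStar σ c w y) (crossedStar σ c w x) := by
  induction x using Finsupp.induction_linear with
  | zero => simp [crossedMul_zero_left, crossedMul_zero_right, crossedStar_zero]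
  | add x x' hx hx' =>
    simp [crossedMul_add_left, crossedMul_add_right, crossedStar_add c w hσ, hx, hx']
  | single g r =>
  induction y using Finsupp.induction_linear with
  | zero => simp [crossedMul_zero_left, crossedMul_zero_right, crossedStar_zero]
  | add y y' hy hy' =>
    simp [crossedMul_add_left, crossedMul_add_right, crossedStar_add c w hσ, hy, hy']
  | single h s =>
  have hu : IsUnit (c (g * h)⁻¹ (σ (τ g h : R))) := (hσ.isUnit_map (τ g h).isUnit).map _
  simp only [crossedMul_single, crossedStar_single c w hσ, mul_inv_rev]
  congr 1
  rw [hw2, hσ.2.2.1, hσ.2.2.1]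
  simp only [map_mul, mul_assoc, mul_inv_rev] at hu ⊢
  rw [← mul_assoc (Ring.inverse _), Ring.inverse_mul_cancel _ hu, one_mul, h1.mul_eq,
    ← mul_assoc (τ h⁻¹ g⁻¹ : R), ← h1.mul_eq, ← mul_assoc (c h⁻¹ (σ s)),
    ← map_mul (c h⁻¹), ← hw4.mul_eq h1 h3 hw]
  simp only [map_mul, mul_assoc]

/-- The explicit formula for the comparison map `S ⊗_R M* → (S ⊗_R M)*`. -/
noncomputable def dualComparison (c : G → R ≃+* R) (τ : G → G → Rˣ) (w : G → R)
    {M : Type w} [AddCommGroup M] [Module R M] (ζ : G →₀ (M →ₗ[R] R)) (z : G →₀ M) : G →₀ R :=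
  ζ.sum fun k f => z.sum fun h x =>
    Finsupp.single (h * k⁻¹) (c h (f x * w k) * (τ h k⁻¹ : R))

variable {M : Type w} [AddCommGroup M] [Module R M]

lemma dualComparison_single (k h : G) (f : M →ₗ[R] R) (x : M) :
    dualComparison c τ w (Finsupp.single k f) (Finsupp.single h x) =
      Finsupp.single (h * k⁻¹) (c h (f x * w k) * (τ h k⁻¹ : R)) := by
  simp [dualComparison]

lemma dualComparison_add_left (ζ ζ' : G →₀ (M →ₗ[R] R)) (z : G →₀ M) :
    dualComparison c τ w (ζ + ζ') z = dualComparison c τ w ζ z + dualComparison c τ w ζ' z := by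
  unfold dualComparison
  rw [Finsupp.sum_add_index'] <;> simp [add_mul, Finsupp.sum_add]

lemma dualComparison_add_right (ζ : G →₀ (M →ₗ[R] R)) (z z' : G →₀ M) :
    dualComparison c τ w ζ (z + z') = dualComparison c τ w ζ z + dualComparison c τ w ζ z' := by
  unfold dualComparison
  rw [← Finsupp.sum_add]
  refine Finsupp.sum_congr fun g _ => ?_
  rw [Finsupp.sum_add_index'] <;> simp [add_mul]

lemma dualComparison_zero_left (z : G →₀ M) : dualComparison c τ w 0 z = 0 := by
  simp [dualComparison]

lemma dualComparison_zero_right (ζ : G →₀ (M →ₗ[R] R)) : dualComparison c τ w ζ 0 = 0 := by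
  simp [dualComparison]

lemma dualComparison_smul (h1 : CondC1 c τ) (h2 : CondC2 c τ)
    (ζ : G →₀ (M →ₗ[R] R)) (u : G →₀ R) (z : G →₀ M) :
    dualComparison c τ w ζ (crossedSMul c τ u z) =
      crossedMul c τ u (dualComparison c τ w ζ z) := by
  induction u using Finsupp.induction_linear with
  | zero => simp [crossedMul_zero_left, crossedSMul_zero_left, dualComparison_zero_right]
  | add u u' hu hu' =>
    simp [crossedMul_add_left, crossedSMul_add_left, dualComparison_add_right, hu, hu']
  | single g r =>
  induction z using Finsupp.induction_linear with
  | zero => simp [crossedMul_zero_right, crossedSMul_zero_right, dualComparison_zero_right]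
  | add z z' hz hz' =>
    simp [crossedMul_add_right, crossedSMul_add_right, dualComparison_add_right, hz, hz']
  | single h x =>
  induction ζ using Finsupp.induction_linear with
  | zero => simp [crossedMul_zero_right, dualComparison_zero_left]
  | add ζ ζ' hζ hζ' => simp [crossedMul_add_right, dualComparison_add_left, hζ, hζ']
  | single k f =>
  simp only [crossedSMul_single, dualComparison_single, crossedMul_single, mul_assoc]
  congr 1
  rw [map_mul (c g), mul_assoc (c g (c h _)), ← h2, ← mul_assoc (c g (c h _)), h1.mul_eq]
  simp [mul_assoc]

lemma dualComparison_smulDual (hσ : IsRingInvolution σ) (h1 : CondC1 c τ) (h2 : CondC2 c τ)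
    (h3 : CondC3 c) (hw : ∀ g, IsUnit (w g)) (hw2 : CondW2 σ c τ w) (hw4 : CondW4 σ c τ w)
    (u : G →₀ R) (ζ : G →₀ (M →ₗ[R] R)) (z : G →₀ M) :
    dualComparison c τ w (crossedSMulDual c τ σ u ζ) z =
      crossedMul c τ (dualComparison c τ w ζ z) (crossedStar σ c w u) := by
  induction u using Finsupp.induction_linear with
  | zero =>
    simp [crossedMul_zero_right, crossedSMulDual_zero_left, dualComparison_zero_left,
      crossedStar_zero]
  | add u u' hu hu' =>
    simp [crossedMul_add_right, crossedSMulDual_add_left c τ hσ, dualComparison_add_left,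
      crossedStar_add c w hσ, hu, hu']
  | single g r =>
  induction ζ using Finsupp.induction_linear with
  | zero => simp [crossedMul_zero_left, crossedSMulDual_zero_right, dualComparison_zero_left]
  | add ζ ζ' hζ hζ' =>
    simp [crossedMul_add_left, crossedSMulDual_add_right, dualComparison_add_left, hζ, hζ']
  | single k f =>
  induction z using Finsupp.induction_linear with
  | zero => simp [crossedMul_zero_left, dualComparison_zero_right]
  | add z z' hz hz' => simp [crossedMul_add_left, dualComparison_add_right, hz, hz']
  | single h x =>
  have factor (a : R) (l : G) (b : R) :
      Finsupp.single (h * l⁻¹) (c h (a * b) * (τ h l⁻¹ : R)) =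
        crossedMul c τ (Finsupp.single h (c h a)) (Finsupp.single l⁻¹ b) := by
    rw [crossedMul_single, map_mul]
  have star_mul := crossedStar_mul hσ h1 h3 hw hw2 hw4 (Finsupp.single g r) (Finsupp.single k 1)
  simp only [crossedMul_single, map_one, mul_one, crossedStar_single c w hσ, hσ.1] at star_mul
  rw [crossedSMulDual_single c τ hσ, dualComparison_single, dualComparison_single,
    factor _ k, crossedMul_assoc h1 h2, crossedStar_single c w hσ,
    crossedMul_single c τ k⁻¹ g⁻¹, ← star_mul]
  simp only [dualSMul, LinearMap.coe_mk, AddHom.coe_mk]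
  rw [mul_assoc, ← hw4.mul_eq h1 h3 hw, RingEquiv.apply_symm_apply, factor]

theorem isDualComparison_dualComparison (hσ : IsRingInvolution σ) (h1 : CondC1 c τ)
    (h2 : CondC2 c τ) (h3 : CondC3 c) (h4 : CondC4 τ) (hw : ∀ g, IsUnit (w g))
    (hw1 : CondW1 w) (hw2 : CondW2 σ c τ w) (hw4 : CondW4 σ c τ w) :
    IsDualComparison c τ σ w (dualComparison c τ w (M := M)) := by
  refine ⟨fun ζ => ⟨dualComparison_add_right ζ, dualComparison_smul h1 h2 ζ⟩,
    dualComparison_add_left, dualComparison_smulDual hσ h1 h2 h3 hw hw2 hw4, ?_⟩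
  intro u v f m
  rw [dualComparison_smulDual hσ h1 h2 h3 hw hw2 hw4, dualComparison_smul h1 h2,
    dualComparison_single]
  have e' : w 1 = 1 := hw1
  simp [h3.apply, h4 _, e', -Finsupp.single_mul]

lemma crossedSMul_single_one (h5 : CondC5 τ) (g : G) (x : M) :
    crossedSMul c τ (Finsupp.single g 1) (Finsupp.single 1 x) = Finsupp.single g x := by
  simp [crossedSMul_single, h5 g]

theorem IsDualComparison.eq_dualComparison (hσ : IsRingInvolution σ) (h5 : CondC5 τ)
    {B : (G →₀ (M →ₗ[R] R)) → (G →₀ M) → (G →₀ R)} (hB : IsDualComparison c τ σ w B) :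
    B = dualComparison c τ w := by
  obtain ⟨hz, hζ, -, hs⟩ := hB
  funext ζ z
  induction ζ using Finsupp.induction_linear with
  | zero =>
    have h := hζ 0 0 z
    rw [add_zero, right_eq_add] at h
    rw [h, dualComparison_zero_left]
  | add ζ ζ' h h' => rw [hζ, h, h', dualComparison_add_left]
  | single k f =>
  induction z using Finsupp.induction_linear with
  | zero =>
    have h := (hz (Finsupp.single k f)).1 0 0
    rw [add_zero, right_eq_add] at h
    rw [h, dualComparison_zero_right]
  | add z z' h h' => rw [(hz _).1, h, h', dualComparison_add_right]
  | single h x =>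
  have := hs (Finsupp.single k 1) (Finsupp.single h 1) f x
  rw [crossedSMul_single_one h5, crossedSMulDual_single c τ hσ] at this
  simpa [h5 _, dualSMul_one hσ, crossedMul_single, crossedStar_single c w hσ, hσ.1,
    dualComparison_single] using this

lemma dualComparison_comp {M' : Type w} [AddCommGroup M'] [Module R M'] (q : M →ₗ[R] M')
    (ζ : G →₀ (M' →ₗ[R] R)) (z : G →₀ M) :
    dualComparison c τ w
        (Finsupp.mapRange (fun F : M' →ₗ[R] R => F.comp q) (LinearMap.zero_comp q) ζ) z =
      dualComparison c τ w ζ (Finsupp.mapRange (fun x : M => q x) (map_zero q) z) := by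
  unfold dualComparison
  rw [Finsupp.sum_mapRange_index (by simp)]
  refine Finsupp.sum_congr fun k _ => ?_
  rw [Finsupp.sum_mapRange_index (by simp)]
  rfl

lemma dualComparison_single_one_apply (h3 : CondC3 c) (h4 : CondC4 τ)
    (ζ : G →₀ (M →ₗ[R] R)) (m : M) (g : G) :
    dualComparison c τ w ζ (Finsupp.single 1 m) g⁻¹ = ζ g m * w g := by
  classical
  induction ζ using Finsupp.induction_linear with
  | zero => simp [dualComparison_zero_left]
  | add ζ ζ' h h' => simp [dualComparison_add_left, h, h', add_mul]
  | single k f =>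
  rw [dualComparison_single, one_mul, h3.apply, h4]
  by_cases hk : k = g
  · simp [hk]
  · simp [hk]

lemma dualComparison_injective (h3 : CondC3 c) (h4 : CondC4 τ) (hw : ∀ g, IsUnit (w g)) :
    Function.Injective (dualComparison c τ w (M := M)) := by
  intro ζ ζ' h
  ext g m
  rw [← (hw g).mul_left_inj, ← dualComparison_single_one_apply h3 h4,
    ← dualComparison_single_one_apply h3 h4, h]

lemma crossedMul_single_one_left (h3 : CondC3 c) (h4 : CondC4 τ) (r : R) (x : G →₀ R) (g : G) :
    crossedMul c τ (Finsupp.single 1 r) x g = r * x g := by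
  classical
  induction x using Finsupp.induction_linear with
  | zero => simp [crossedMul_zero_right]
  | add x x' h h' => simp [crossedMul_add_right, h, h', mul_add]
  | single k s =>
  rw [crossedMul_single, one_mul, h3.apply, h4]
  by_cases hk : k = g
  · simp [hk]
  · simp [hk]

lemma exists_dualComparison_eq [Module.Finite R M] (h1 : CondC1 c τ) (h2 : CondC2 c τ)
    (h3 : CondC3 c) (h4 : CondC4 τ) (h5 : CondC5 τ) (hw : ∀ g, IsUnit (w g))
    (F : (G →₀ M) → (G →₀ R)) (hadd : ∀ z z' : G →₀ M, F (z + z') = F z + F z')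
    (hsmul : ∀ (u : G →₀ R) (z : G →₀ M), F (crossedSMul c τ u z) = crossedMul c τ u (F z)) :
    ∃ ζ : G →₀ (M →ₗ[R] R), dualComparison c τ w ζ = F := by
  classical
  have hF_smul (r : R) (m : M) (g : G) :
      F (Finsupp.single 1 (r • m)) g = r * F (Finsupp.single 1 m) g := by
    rw [← crossedMul_single_one_left h3 h4, ← hsmul, crossedSMul_single, one_mul, h3, h4]
    simp
  let φ (g : G) : M →ₗ[R] R :=
    { toFun := fun m => F (Finsupp.single 1 m) g⁻¹ * Ring.inverse (w g)
      map_add' := fun x y => by rw [Finsupp.single_add, hadd, Finsupp.add_apply, add_mul]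
      map_smul' := fun r x => by rw [hF_smul, mul_assoc]; rfl }
  obtain ⟨T, hT⟩ := Module.Finite.fg_top (R := R) (M := M)
  let A : Finset G := T.biUnion fun m => (F (Finsupp.single 1 m)).support.image (·⁻¹)
  have hφ (g : G) (hg : φ g ≠ 0) : g ∈ A := by
    contrapose! hg
    refine LinearMap.ext_on hT fun m hm => ?_
    have : F (Finsupp.single 1 m) g⁻¹ = 0 := by
      by_contra hne
      exact hg (Finset.mem_biUnion.2 ⟨m, hm, Finset.mem_image.2
        ⟨g⁻¹, Finsupp.mem_support_iff.2 hne, inv_inv g⟩⟩)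
    simp [φ, this]
  refine ⟨Finsupp.onFinset A φ hφ, funext fun z => ?_⟩
  induction z using Finsupp.induction_linear with
  | zero =>
    have h := hadd 0 0
    rw [add_zero, right_eq_add] at h
    rw [h, dualComparison_zero_right]
  | add z z' h h' => rw [hadd, dualComparison_add_right, h, h']
  | single h x =>
  rw [← crossedSMul_single_one (c := c) h5, hsmul, dualComparison_smul h1 h2]
  congr 1
  ext g
  have := dualComparison_single_one_apply (w := w) h3 h4 (Finsupp.onFinset A φ hφ) x g⁻¹
  rw [inv_inv] at this
  rw [this]
  simp [φ, mul_assoc, Ring.inverse_mul_cancel _ (hw g⁻¹)]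

end CrossedProduct

/-- under (C1)–(C5), an involution `σ` of `R` and the `w`-conditions (W1)–(W4)
(so that `S = R ∗_{c,τ} G` carries the involution `σ̂` determined by `w`): for every left
`R`-module `M` there is a well-defined `S`-linear map `β(M) : S ⊗_R M* → (S ⊗_R M)*` with
`β(M)(u ⊗ f)(v ⊗ m) = v·f(m)·σ̂(u)`; it is natural in `M`; and it is bijective (injective,
and surjective onto the `S`-linear functionals) whenever `M` is finitely generated free. -/
theorem dual_comparison_exists_natural_bijective
    (c : G → R ≃+* R) (τ : G → G → Rˣ) (σ : R → R) (w : G → R)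
    (hσ : IsRingInvolution σ)
    (h1 : CondC1 c τ) (h2 : CondC2 c τ) (h3 : CondC3 c) (h4 : CondC4 τ) (h5 : CondC5 τ)
    (hw1 : CondW1 w) (hw2 : CondW2 σ c τ w) (hw3 : CondW3 σ c τ w) (hw4 : CondW4 σ c τ w) :
    -- existence, for every left `R`-module `M`
    (∀ (M : Type w) [AddCommGroup M] [Module R M],
      ∃ B : (G →₀ (M →ₗ[R] R)) → ((G →₀ M) → (G →₀ R)),
        IsDualComparison c τ σ w B) ∧
    -- naturality in `M`
    (∀ (M M' : Type w) [AddCommGroup M] [Module R M] [AddCommGroup M'] [Module R M']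
        (q : M →ₗ[R] M')
        (B : (G →₀ (M →ₗ[R] R)) → ((G →₀ M) → (G →₀ R)))
        (B' : (G →₀ (M' →ₗ[R] R)) → ((G →₀ M') → (G →₀ R))),
      IsDualComparison c τ σ w B → IsDualComparison c τ σ w B' →
      ∀ (ζ : G →₀ (M' →ₗ[R] R)) (z : G →₀ M),
        B (Finsupp.mapRange (fun F : M' →ₗ[R] R => F.comp q) (LinearMap.zero_comp q) ζ) z =
          B' ζ (Finsupp.mapRange (fun x : M => q x) (map_zero q) z)) ∧
    -- bijectivity for finitely generated free `M`
    (∀ (M : Type w) [AddCommGroup M] [Module R M] [Module.Free R M] [Module.Finite R M]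
        (B : (G →₀ (M →ₗ[R] R)) → ((G →₀ M) → (G →₀ R))),
      IsDualComparison c τ σ w B →
      Function.Injective B ∧
      ∀ F : (G →₀ M) → (G →₀ R),
        (∀ z z' : G →₀ M, F (z + z') = F z + F z') →
        (∀ (u : G →₀ R) (z : G →₀ M),
          F (crossedSMul c τ u z) = crossedMul c τ u (F z)) →
        ∃ ζ : G →₀ (M →ₗ[R] R), B ζ = F) := by
  have hw := hw2.isUnit hσ hw1
  refine ⟨fun M _ _ => ⟨_, isDualComparison_dualComparison hσ h1 h2 h3 h4 hw hw1 hw2 hw4⟩, ?_, ?_⟩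
  · intro M M' _ _ _ _ q B B' hB hB' ζ z
    rw [hB.eq_dualComparison hσ h5, hB'.eq_dualComparison hσ h5]
    exact dualComparison_comp q ζ z
  · intro M _ _ _ _ B hB
    rw [hB.eq_dualComparison hσ h5]
    exact ⟨dualComparison_injective h3 h4 hw, exists_dualComparison_eq h1 h2 h3 h4 h5 hw⟩
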